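/- For all natural numbers p ≥ n·z and q ≥ 1, the number of words w over Γ with ||w|| = p + q + n·z, |w|_{b_i} = n_i for each i, and having a prefix of weight exactly p, equals the number of such words having a prefix of weight exactly p + 1 (Theorem 2.1: there is a bijection between these two sets). -/

import Mathlib

/-- The alphabet `Γ = {a, b₁, …, bₘ}`: `none` encodes the letter `a`, and
`some i` encodes the letter `bᵢ`. -/
abbrev Letter (m : ℕ) := Option (Fin m)

/-- The grading of letters: `‖a‖ = 1` and `‖bᵢ‖ = zᵢ + 1`. -/
def letterWt {m : ℕ} (z : Fin m → ℕ) : Letter m → ℕ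
  | none => 1
  | some i => z i + 1

/-- The weight `‖w‖` of a word: the sum of the weights of its letters. -/
def wordWt {m : ℕ} (z : Fin m → ℕ) (w : List (Letter m)) : ℕ :=
  (w.map (letterWt z)).sum

/-- The dot product `k·z = k₁z₁ + ⋯ + kₘzₘ` of multi-indices. -/
def mdot {m : ℕ} (k z : Fin m → ℕ) : ℕ := ∑ i, k i * z i

@[simp]
theorem wordWt_nil {m : ℕ} (z : Fin m → ℕ) : wordWt z [] = 0 := rfl

@[simp]
theorem wordWt_cons {m : ℕ} (z : Fin m → ℕ) (c : Letter m) (w : List (Letter m)) :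
    wordWt z (c :: w) = letterWt z c + wordWt z w := by
  simp [wordWt]

@[simp]
theorem wordWt_append {m : ℕ} (z : Fin m → ℕ) (u v : List (Letter m)) :
    wordWt z (u ++ v) = wordWt z u + wordWt z v := by
  simp [wordWt]

theorem letterWt_pos {m : ℕ} (z : Fin m → ℕ) (c : Letter m) : 0 < letterWt z c := by
  cases c <;> simp [letterWt]

/-- A word is determined by its weight among the prefixes of a given word. -/
theorem eq_of_append_eq_append_of_wordWt_eq {m : ℕ} {z : Fin m → ℕ}
    {u v u' v' : List (Letter m)} (h : u ++ v = u' ++ v') (hu : wordWt z u = wordWt z u') :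
    u = u' ∧ v = v' := by
  induction u generalizing u' with
  | nil =>
    cases u' with
    | nil => exact ⟨rfl, h⟩
    | cons c u' =>
      have := letterWt_pos z c
      simp at hu
      omega
  | cons c u ih =>
    cases u' with
    | nil =>
      have := letterWt_pos z c
      simp at hu
      omega
    | cons c' u' =>
      simp only [List.cons_append, List.cons.injEq] at h
      obtain ⟨rfl, h⟩ := h
      simp only [wordWt_cons, Nat.add_left_cancel_iff] at hu
      obtain ⟨rfl, rfl⟩ := ih h hu
      exact ⟨rfl, rfl⟩

theorem mdot_add_single {m : ℕ} (n z : Fin m → ℕ) (i : Fin m) :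
    mdot (n + Pi.single i 1) z = mdot n z + z i := by
  simp [mdot, add_mul, Finset.sum_add_distrib, Pi.single_apply]

/-- Pairs of words of weights `x` and `y` which together contain `n i` letters `bᵢ`. -/
def splitWords {m : ℕ} (z n : Fin m → ℕ) (x y : ℕ) : Set (List (Letter m) × List (Letter m)) :=
  {s | wordWt z s.1 = x ∧ wordWt z s.2 = y ∧
    ∀ i, s.1.count (some i) + s.2.count (some i) = n i}

/-- Pairs of words which, with the letter `c` put between them, contain `n i` letters `bᵢ`, the
first having weight `x` when followed by `c` and the second having weight `y`. -/
def splitWordsLeft {m : ℕ} (z n : Fin m → ℕ) (x y : ℕ) (c : Letter m) :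
    Set (List (Letter m) × List (Letter m)) :=
  {s | wordWt z s.1 + letterWt z c = x ∧ wordWt z s.2 = y ∧
    ∀ i, s.1.count (some i) + s.2.count (some i) + [c].count (some i) = n i}

/-- Pairs of words which, with the letter `c` put between them, contain `n i` letters `bᵢ`, the
first having weight `x` and the second having weight `y` when preceded by `c`. -/
def splitWordsRight {m : ℕ} (z n : Fin m → ℕ) (x y : ℕ) (c : Letter m) :
    Set (List (Letter m) × List (Letter m)) :=
  {s | wordWt z s.1 = x ∧ wordWt z s.2 + letterWt z c = y ∧
    ∀ i, s.1.count (some i) + s.2.count (some i) + [c].count (some i) = n i}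

theorem nonempty_sigma_splitWordsLeft_equiv {m : ℕ} (z n : Fin m → ℕ) (x y : ℕ) :
    Nonempty ((Σ c, splitWordsLeft z n (x + 1) y c) ≃ splitWords z n (x + 1) y) := by
  refine ⟨Equiv.ofBijective
    (fun s => ⟨(s.2.1.1 ++ [s.1], s.2.1.2), ?_, s.2.2.2.1, fun i => ?_⟩) ⟨?_, ?_⟩⟩
  · simpa using s.2.2.1
  · have := s.2.2.2.2 i
    simp only [List.count_append]
    lia
  · rintro ⟨c, ⟨u, v⟩, h⟩ ⟨c', ⟨u', v'⟩, h'⟩ e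
    obtain ⟨e, rfl⟩ := Prod.mk.inj (Subtype.ext_iff.mp e)
    obtain ⟨rfl, e⟩ := List.append_inj' e rfl
    obtain rfl := List.singleton_inj.mp e
    rfl
  · rintro ⟨⟨w, v⟩, hw, hv, hc⟩
    rcases List.eq_nil_or_concat w with rfl | ⟨u, c, rfl⟩
    · simp at hw
    · refine ⟨⟨c, ⟨(u, v), ?_, hv, fun i => ?_⟩⟩, ?_⟩
      · simpa using hw
      · have := hc i
        simp only [List.concat_eq_append, List.count_append] at this ⊢
        lia
      · simp

theorem nonempty_sigma_splitWordsRight_equiv {m : ℕ} (z n : Fin m → ℕ) (x y : ℕ) :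
    Nonempty ((Σ c, splitWordsRight z n x (y + 1) c) ≃ splitWords z n x (y + 1)) := by
  refine ⟨Equiv.ofBijective
    (fun s => ⟨(s.2.1.1, s.1 :: s.2.1.2), s.2.2.1, ?_, fun i => ?_⟩) ⟨?_, ?_⟩⟩
  · simpa [add_comm] using s.2.2.2.1
  · have := s.2.2.2.2 i
    simp only [List.count_cons, List.count_nil] at this ⊢
    lia
  · rintro ⟨c, ⟨u, v⟩, h⟩ ⟨c', ⟨u', v'⟩, h'⟩ e
    obtain ⟨rfl, e⟩ := Prod.mk.inj (Subtype.ext_iff.mp e)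
    obtain ⟨rfl, rfl⟩ := List.cons.inj e
    rfl
  · rintro ⟨⟨u, w⟩, hu, hw, hc⟩
    cases w with
    | nil => simp at hw
    | cons c v =>
      refine ⟨⟨c, ⟨(u, v), hu, ?_, fun i => ?_⟩⟩, rfl⟩
      · simpa [add_comm] using hw
      · have := hc i
        simp only [List.count_cons, List.count_nil] at this ⊢
        lia

theorem count_some_singleton {m : ℕ} (i j : Fin m) :
    [(some i : Letter m)].count (some j) = (Pi.single i 1 : Fin m → ℕ) j := by
  simp [List.count_singleton, Pi.single_apply, eq_comm (a := i)]

theorem splitWordsLeft_some {m : ℕ} (z n : Fin m → ℕ) (x y : ℕ) (i : Fin m) :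
    splitWordsLeft z (n + Pi.single i 1) (x + z i + 1) y (some i) = splitWords z n x y := by
  ext ⟨u, v⟩
  simp [splitWordsLeft, splitWords, letterWt, ← add_assoc, count_some_singleton]

theorem splitWordsRight_some {m : ℕ} (z n : Fin m → ℕ) (x y : ℕ) (i : Fin m) :
    splitWordsRight z (n + Pi.single i 1) x (y + z i + 1) (some i) = splitWords z n x y := by
  ext ⟨u, v⟩
  simp [splitWordsRight, splitWords, letterWt, ← add_assoc, count_some_singleton]

theorem splitWordsLeft_none {m : ℕ} (z n : Fin m → ℕ) (x y : ℕ) :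
    splitWordsLeft z n (x + 1) y none = splitWordsRight z n x (y + 1) none := by
  ext ⟨u, v⟩
  simp [splitWordsLeft, splitWordsRight, letterWt]

/-- If all four weights are at least `n·z`, the number of pairs of words in `splitWords z n x y`
depends only on `x + y`. -/
theorem nonempty_splitWords_equiv {m : ℕ} (z n : Fin m → ℕ) {x y : ℕ} (d : ℕ)
    (hx : mdot n z ≤ x) (hy : mdot n z ≤ y) :
    Nonempty (splitWords z n (x + d) y ≃ splitWords z n x (y + d)) := by
  induction hN : ∑ i, n i using Nat.strong_induction_on generalizing n x y d with
  | _ N ih =>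
  subst hN
  have step {x y : ℕ} (hx : mdot n z ≤ x) (hy : mdot n z ≤ y) :
      Nonempty (splitWords z n (x + 1) y ≃ splitWords z n x (y + 1)) := by
    obtain ⟨e₁⟩ := nonempty_sigma_splitWordsLeft_equiv z n x y
    obtain ⟨e₂⟩ := nonempty_sigma_splitWordsRight_equiv z n x y
    have key (c : Letter m) : Nonempty
        (splitWordsLeft z n (x + 1) y c ≃ splitWordsRight z n x (y + 1) c) := by
      cases c with
      | none => exact ⟨Equiv.setCongr (splitWordsLeft_none z n x y)⟩
      | some i =>
        by_cases hi : n i = 0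
        · have h₁ : IsEmpty (splitWordsLeft z n (x + 1) y (some i)) :=
            ⟨fun s => by simpa [hi] using s.2.2.2 i⟩
          have h₂ : IsEmpty (splitWordsRight z n x (y + 1) (some i)) :=
            ⟨fun s => by simpa [hi] using s.2.2.2 i⟩
          exact ⟨Equiv.equivOfIsEmpty _ _⟩
        · obtain ⟨n, rfl⟩ : ∃ n' : Fin m → ℕ, n = n' + Pi.single i 1 := by
            refine ⟨n - Pi.single i 1, ?_⟩
            ext j
            by_cases hj : j = i
            · subst hj
              simp
              omega
            · simp [hj]
          rw [mdot_add_single] at hx hy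
          obtain ⟨x, rfl⟩ := Nat.exists_eq_add_of_le' ((Nat.le_add_left _ _).trans hx)
          obtain ⟨y, rfl⟩ := Nat.exists_eq_add_of_le' ((Nat.le_add_left _ _).trans hy)
          rw [splitWordsLeft_some, splitWordsRight_some]
          obtain ⟨e⟩ := ih (∑ j, n j) (by simp [Finset.sum_add_distrib]) n (z i)
            (Nat.le_of_add_le_add_right hx) (Nat.le_of_add_le_add_right hy) rfl
          exact ⟨e.symm⟩
    exact ⟨e₁.symm.trans ((Equiv.sigmaCongrRight fun c => (key c).some).trans e₂)⟩
  clear ih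
  induction d generalizing y with
  | zero => exact ⟨Equiv.refl _⟩
  | succ d ihd =>
    obtain ⟨e₁⟩ := step (x := x + d) (Nat.le_add_right_of_le hx) hy
    obtain ⟨e₂⟩ := ihd (y := y + 1) (Nat.le_add_right_of_le hy)
    rw [add_right_comm y 1 d] at e₂
    exact ⟨e₁.trans e₂⟩

theorem nonempty_splitWords_equiv_words {m : ℕ} (z n : Fin m → ℕ) (x y : ℕ) :
    Nonempty (splitWords z n x y ≃ {w : List (Letter m) //
      wordWt z w = x + y ∧ (∀ i, w.count (some i) = n i) ∧
      ∃ u : List (Letter m), u <+: w ∧ wordWt z u = x}) := by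
  refine ⟨Equiv.ofBijective (fun s => ⟨s.1.1 ++ s.1.2, ?_, fun i => ?_,
    s.1.1, List.prefix_append _ _, s.2.1⟩) ⟨?_, ?_⟩⟩
  · rw [wordWt_append, s.2.1, s.2.2.1]
  · rw [List.count_append, s.2.2.2 i]
  · rintro ⟨⟨u, v⟩, h⟩ ⟨⟨u', v'⟩, h'⟩ e
    obtain ⟨rfl, rfl⟩ :=
      eq_of_append_eq_append_of_wordWt_eq (Subtype.ext_iff.mp e) (h.1.trans h'.1.symm)
    rfl
  · rintro ⟨_, hw, hc, u, ⟨v, rfl⟩, hu⟩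
    refine ⟨⟨(u, v), hu, ?_, fun i => ?_⟩, rfl⟩
    · simpa [hu] using hw
    · simpa using hc i

/-- **Theorem 2.1**: for `p ≥ n·z` and `q ≥ 1`, the number of words `w` over `Γ` with
`‖w‖ = p + q + n·z`, `|w|_{bᵢ} = nᵢ` for each `i`, and having a prefix of weight
exactly `p` equals the number of such words having a prefix of weight exactly `p + 1`. -/
theorem card_prefix_p_eq_card_prefix_p_succ (m : ℕ) (hm : 0 < m) (z n : Fin m → ℕ)
    (p q : ℕ) (hp : mdot n z ≤ p) (hq : 1 ≤ q) :
    Nat.card {w : List (Letter m) //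
        wordWt z w = p + q + mdot n z ∧ (∀ i, w.count (some i) = n i) ∧
        ∃ u : List (Letter m), u <+: w ∧ wordWt z u = p} =
      Nat.card {w : List (Letter m) //
        wordWt z w = p + q + mdot n z ∧ (∀ i, w.count (some i) = n i) ∧
        ∃ u : List (Letter m), u <+: w ∧ wordWt z u = p + 1} := by
  obtain ⟨q, rfl⟩ := Nat.exists_eq_add_of_le' hq
  obtain ⟨e₀⟩ := nonempty_splitWords_equiv_words z n p (q + mdot n z + 1)
  obtain ⟨e₁⟩ := nonempty_splitWords_equiv_words z n (p + 1) (q + mdot n z)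
  obtain ⟨e⟩ := nonempty_splitWords_equiv z n 1 hp (Nat.le_add_left (mdot n z) q)
  rw [show p + (q + mdot n z + 1) = p + (q + 1) + mdot n z by ring] at e₀
  rw [show p + 1 + (q + mdot n z) = p + (q + 1) + mdot n z by ring] at e₁
  exact Nat.card_congr (e₀.symm.trans (e.symm.trans e₁))
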